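/- arXiv:1911.09866 — 3 statements merged into one kernel-verified Lean document; each statement's English description precedes it below -/
import Mathlib

section
/- Let BT be an n-vertex chemical tree with exactly b branching vertices, where 1 ≤ b < n/2 − 1. If 1 ≤ b < (n−2)/3, then M1(BT) ≤ 2(2n+3b−3), with equality if and only if BT has exactly b vertices of degree 4, n−3b−2 vertices of degree 2, 2b+2 vertices of degree 1 and no vertex of degree 3. If (n−2)/3 ≤ b < n/2 − 1, then M1(BT) ≤ 2(4n−3b−7), with equality if and only if BT has exactly n−2b−2 vertices of degree 4, 3b−n+2 vertices of degree 3, n−b vertices of degree 1 and no vertex of degree 2. -/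
open SimpleGraph

namespace ChemTree

variable {V : Type*}

/-- The degree of a vertex. -/
noncomputable def deg (G : SimpleGraph V) (v : V) : ℕ :=
  (G.neighborSet v).ncard

/-- A chemical tree: a tree in which every vertex has degree at most 4. -/
def IsChemicalTree (G : SimpleGraph V) : Prop :=
  G.IsTree ∧ ∀ v, deg G v ≤ 4

/-- `nDeg G i` is the number of vertices of `G` having degree `i`. -/
noncomputable def nDeg (G : SimpleGraph V) (i : ℕ) : ℕ :=
  {v | deg G v = i}.ncard

/-- The first Zagreb index. -/
noncomputable def M1 (G : SimpleGraph V) [Fintype V] : ℕ :=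
  ∑ v, (deg G v) ^ 2

/-- The second Zagreb index. -/
noncomputable def M2 (G : SimpleGraph V) [Fintype V] : ℕ :=
  ∑ e ∈ (Set.toFinite G.edgeSet).toFinset,
    Sym2.lift ⟨fun u w => deg G u * deg G w, fun u w => Nat.mul_comm _ _⟩ e

/-- A segment: a nontrivial path whose end vertices have degree `≠ 2` and whose
internal vertices all have degree `2`. -/
def IsSegment (G : SimpleGraph V) {u v : V} (p : G.Walk u v) : Prop :=
  p.IsPath ∧ 0 < p.length ∧ deg G u ≠ 2 ∧ deg G v ≠ 2 ∧
    ∀ w ∈ p.support, w ≠ u → w ≠ v → deg G w = 2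

/-- The number of segments: in a tree, a segment is uniquely determined by the
unordered pair of its end vertices. -/
noncomputable def numSegments (G : SimpleGraph V) : ℕ :=
  {s : Sym2 V | ∃ (u v : V) (p : G.Walk u v), s = s(u, v) ∧ IsSegment G p}.ncard

/-- The number of branching vertices (vertices of degree at least 3). -/
noncomputable def numBranching (G : SimpleGraph V) : ℕ :=
  {v | 3 ≤ deg G v}.ncard

/-- An internal path: both end vertices are branching and all internal vertices
have degree `2`. -/
def IsInternalPath (G : SimpleGraph V) {u v : V} (p : G.Walk u v) : Prop :=
  p.IsPath ∧ 0 < p.length ∧ 3 ≤ deg G u ∧ 3 ≤ deg G v ∧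
    ∀ w ∈ p.support, w ≠ u → w ≠ v → deg G w = 2

/-- A pendent path: one end vertex is pendent, the other is branching and all
internal vertices have degree `2`. -/
def IsPendentPath (G : SimpleGraph V) {u v : V} (p : G.Walk u v) : Prop :=
  p.IsPath ∧ 0 < p.length ∧ deg G u = 1 ∧ 3 ≤ deg G v ∧
    ∀ w ∈ p.support, w ≠ u → w ≠ v → deg G w = 2

end ChemTree

open ChemTree

namespace ChemTree

/-- The local notion of degree agrees with `SimpleGraph.degree`. -/
theorem deg_eq_degree {V : Type*} (G : SimpleGraph V) (v : V) [Fintype (G.neighborSet v)] :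
    deg G v = G.degree v := by
  rw [deg, Set.ncard_eq_toFinset_card', ← G.card_neighborFinset_eq_degree v]
  rfl

theorem IsChemicalTree.deg_mem_Icc {V : Type*} [Finite V] [Nontrivial V] {T : SimpleGraph V}
    (hT : IsChemicalTree T) (v : V) : deg T v ∈ Finset.Icc 1 4 := by
  classical
  have := Fintype.ofFinite V
  refine Finset.mem_Icc.2 ⟨?_, hT.2 v⟩
  rw [deg_eq_degree]
  exact hT.1.connected.preconnected.degree_pos_of_nontrivial v

/-- A sum over the vertices of a chemical tree of a function of the degree, grouped by degree. -/
theorem IsChemicalTree.sum_comp_deg {V : Type*} [Fintype V] [Nontrivial V] {T : SimpleGraph V}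
    (hT : IsChemicalTree T) (f : ℕ → ℕ) :
    ∑ v, f (deg T v) =
      nDeg T 1 * f 1 + nDeg T 2 * f 2 + nDeg T 3 * f 3 + nDeg T 4 * f 4 := by
  classical
  have key : ∀ i, ∑ v with deg T v = i, f (deg T v) = nDeg T i * f i := fun i => by
    rw [Finset.sum_congr rfl fun v hv => congrArg f (Finset.mem_filter.1 hv).2,
      Finset.sum_const, smul_eq_mul, nDeg, Set.ncard_eq_toFinset_card', Set.toFinset_ofPred]
  rw [← Finset.sum_fiberwise_of_maps_to (t := Finset.Icc 1 4) fun v _ => hT.deg_mem_Icc v,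
    Finset.sum_congr rfl fun i _ => key i]
  simp [Finset.sum_Icc_succ_top]

/-- In a tree on `n` vertices the degrees add up to `2 * (n - 1)`. -/
theorem sum_deg_add_two {V : Type*} [Fintype V] {T : SimpleGraph V} (hT : T.IsTree) :
    ∑ v, deg T v + 2 = 2 * Fintype.card V := by
  classical
  have h := T.sum_degrees_eq_twice_card_edges
  have h' := hT.card_edgeFinset
  simp only [deg_eq_degree]
  omega

theorem numBranching_eq_sum {V : Type*} [Fintype V] (G : SimpleGraph V) :
    numBranching G = ∑ v, if 3 ≤ deg G v then 1 else 0 := by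
  classical
  rw [numBranching, Set.ncard_eq_toFinset_card', Set.toFinset_ofPred, Finset.card_filter]

end ChemTree

theorem stmt_3 {V : Type*} [Fintype V] (n b : ℕ)
    (hcard : Fintype.card V = n) (hb1 : 1 ≤ b) (hb2 : (b : ℚ) < (n : ℚ) / 2 - 1)
    (T : SimpleGraph V) (hT : IsChemicalTree T) (hbr : numBranching T = b) :
    ((b : ℚ) < ((n : ℚ) - 2) / 3 →
      (M1 T : ℚ) ≤ 2 * (2 * n + 3 * b - 3) ∧
        ((M1 T : ℚ) = 2 * (2 * n + 3 * b - 3) ↔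
          (nDeg T 4 = b ∧ (nDeg T 2 : ℚ) = (n : ℚ) - 3 * b - 2 ∧
          nDeg T 1 = 2 * b + 2 ∧ nDeg T 3 = 0))) ∧
    (((n : ℚ) - 2) / 3 ≤ (b : ℚ) →
      (M1 T : ℚ) ≤ 2 * (4 * n - 3 * b - 7) ∧
        ((M1 T : ℚ) = 2 * (4 * n - 3 * b - 7) ↔
          ((nDeg T 4 : ℚ) = (n : ℚ) - 2 * b - 2 ∧ (nDeg T 3 : ℚ) = 3 * (b : ℚ) - n + 2 ∧
          (nDeg T 1 : ℚ) = (n : ℚ) - b ∧ nDeg T 2 = 0))) := by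
  have hn : 4 < n := by
    have : (1 : ℚ) ≤ b := by exact_mod_cast hb1
    have : (4 : ℚ) < n := by linarith
    exact_mod_cast this
  have : Nontrivial V := Fintype.one_lt_card_iff_nontrivial.1 (by omega)
  have h_card := hT.sum_comp_deg fun _ => 1
  have h_deg := hT.sum_comp_deg fun i => i
  have h_branching := hT.sum_comp_deg fun i => if 3 ≤ i then 1 else 0
  have h_M1 : M1 T = _ := hT.sum_comp_deg fun i => i ^ 2
  have h_tree := sum_deg_add_two hT.1
  rw [← numBranching_eq_sum, hbr] at h_branching
  simp only [Finset.sum_const, Finset.card_univ, smul_eq_mul, mul_one, hcard] at h_card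
  rw [h_deg, hcard] at h_tree
  norm_num at h_branching h_M1
  have e_two : (nDeg T 2 : ℚ) + nDeg T 4 = n - 2 - 2 * b := by
    qify at h_card h_tree h_branching
    linarith
  have e_one : (nDeg T 1 : ℚ) + nDeg T 2 = n - b := by
    qify at h_card h_branching
    linarith
  have e_three : (nDeg T 3 : ℚ) + nDeg T 4 = b := by exact_mod_cast h_branching.symm
  have e_M1 : (M1 T : ℚ) = 4 * n + 2 * b - 6 + 4 * nDeg T 4 := by
    qify at h_M1
    linarith
  have n_two : (0 : ℚ) ≤ nDeg T 2 := Nat.cast_nonneg _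
  have n_three : (0 : ℚ) ≤ nDeg T 3 := Nat.cast_nonneg _
  refine ⟨fun _ => ⟨by linarith, fun h => ?_, fun h => ?_⟩,
    fun _ => ⟨by linarith, fun h => ?_, fun h => ?_⟩⟩
  · refine ⟨?_, by linarith, ?_, ?_⟩ <;> qify <;> linarith
  · have h_four : (nDeg T 4 : ℚ) = b := by exact_mod_cast h.1
    linarith
  · refine ⟨by linarith, by linarith, by linarith, ?_⟩
    qify
    linarith
  · linarith [h.1]
end

section
/- Let 3 ≤ k ≤ n−1 and let T be an n-vertex chemical tree with exactly k segments such that M2(T') ≤ M2(T) for every n-vertex chemical tree T' with exactly k segments. Then T does not contain any internal path of length greater than 1. -/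
open SimpleGraph

open ChemTree

namespace ChemTree

variable {V : Type*} {G : SimpleGraph V}

lemma ncard_neighborSet_eq_degree (G : SimpleGraph V) (v : V)
    [Fintype (G.neighborSet v)] : (G.neighborSet v).ncard = G.degree v := by
  rw [Set.ncard_eq_toFinset_card', ← SimpleGraph.card_neighborSet_eq_degree, Set.toFinset_card]

lemma IsSegment.reverse {u v : V} {p : G.Walk u v} (hp : IsSegment G p) :
    IsSegment G p.reverse := by
  obtain ⟨h₁, h₂, h₃, h₄, h₅⟩ := hp
  refine ⟨h₁.reverse, by simpa using h₂, h₄, h₃, fun w hw hwv hwu => h₅ w ?_ hwu hwv⟩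
  simpa using hw

/-- The graph joining the end vertices of each segment. -/
def segmentGraph (G : SimpleGraph V) : SimpleGraph V where
  Adj u v := ∃ p : G.Walk u v, IsSegment G p
  symm := ⟨fun _ _ ⟨p, hp⟩ => ⟨p.reverse, hp.reverse⟩⟩
  loopless := ⟨fun _ ⟨p, hp⟩ => by
    have h := hp.2.1
    rw [Walk.length_eq_zero_iff.mpr (Walk.isPath_iff_nil.mp hp.1)] at h
    exact h.false⟩

lemma numSegments_eq_ncard_edgeSet (G : SimpleGraph V) :
    numSegments G = (segmentGraph G).edgeSet.ncard := by
  unfold numSegments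
  congr 1
  ext s
  induction s with | _ u v
  constructor
  · rintro ⟨a, b, p, hs, hp⟩
    rw [hs]
    exact ⟨p, hp⟩
  · rintro ⟨p, hp⟩
    exact ⟨u, v, p, rfl, hp⟩

/-- Two paths through degree two vertices which start with the same edge end at the same vertex. -/
lemma end_eq_of_deg_two [Finite V] {t a v w : V} (h : G.Adj t a) (p : G.Walk a v) (q : G.Walk a w)
    (hp : (Walk.cons h p).IsPath) (hq : (Walk.cons h q).IsPath) (hv : deg G v ≠ 2)
    (hw : deg G w ≠ 2) (hp2 : ∀ x ∈ p.support, x ≠ v → deg G x = 2)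
    (hq2 : ∀ x ∈ q.support, x ≠ w → deg G x = 2) : v = w := by
  induction p generalizing t with
  | nil =>
    by_contra hne
    exact hv (hq2 _ q.start_mem_support hne)
  | @cons a b v hab p ih =>
    have hp' := (Walk.cons_isPath_iff _ _).mp hp
    have hq' := (Walk.cons_isPath_iff _ _).mp hq
    have hpa := (Walk.cons_isPath_iff _ _).mp hp'.1
    have hav : a ≠ v := fun e => hpa.2 (e ▸ p.end_mem_support)
    have ha : deg G a = 2 := hp2 a (by simp) hav
    cases q with
    | nil => exact absurd ha hw
    | @cons _ c _ hac q =>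
      have hbt : t ≠ b := fun e => hp'.2 (by rw [e]; simp)
      have hct : t ≠ c := fun e => hq'.2 (by rw [e]; simp)
      have hbc : b = c := by
        by_contra hne
        have : 2 < (G.neighborSet a).ncard :=
          (Set.two_lt_ncard (Set.toFinite _)).mpr ⟨t, h.symm, b, hab, c, hac, hbt, hct, hne⟩
        unfold deg at ha
        omega
      subst hbc
      exact ih hab q hp'.1 hq'.1 hv (fun x hx => hp2 x (by simp [hx]))
        (fun x hx => hq2 x (by simp [hx]))

lemma exists_longest_path [Fintype V] {t : V} (Q : ∀ a, G.Walk t a → Prop)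
    (hQ : ∀ a p, Q a p → p.IsPath) (hne : ∃ a p, Q a p) :
    ∃ a p, Q a p ∧ ∀ b q, Q b q → q.length ≤ p.length := by
  have hbdd : BddAbove {n | ∃ a p, Q a p ∧ p.length = n} := by
    refine ⟨Fintype.card V, ?_⟩
    rintro _ ⟨a, p, hp, rfl⟩
    exact (hQ a p hp).length_lt.le
  obtain ⟨a₀, p₀, h₀⟩ := hne
  obtain ⟨a, p, hp, hl⟩ := Nat.sSup_mem (s := {n | ∃ a p, Q a p ∧ p.length = n})
    ⟨_, a₀, p₀, h₀, rfl⟩ hbdd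
  refine ⟨a, p, hp, fun b q hq => ?_⟩
  rw [hl]
  exact le_csSup hbdd ⟨b, q, hq, rfl⟩

/-- In a forest, a nontrivial path ending at a vertex of degree at least two can be extended. -/
lemma exists_concat_isPath [Finite V] (hG : G.IsAcyclic) {u v : V} {p : G.Walk u v}
    (hp : p.IsPath) (hv : 2 ≤ deg G v) : ∃ w, ∃ h : G.Adj v w, (p.concat h).IsPath := by
  obtain ⟨w, hw, hne⟩ := Set.exists_ne_of_one_lt_ncard (s := G.neighborSet v) hv p.penultimate
  exact ⟨w, hw, hp.concat (fun hmem => hne (hG.eq_penultimate_of_adj_end hp hw hmem)) hw⟩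

lemma exists_isSegment_cons [Fintype V] (hG : G.IsAcyclic) {u t : V} (hu : deg G u ≠ 2)
    (h : G.Adj u t) : ∃ v, ∃ p : G.Walk t v, IsSegment G (Walk.cons h p) := by
  obtain ⟨v, p, ⟨hp, hp2⟩, hmax⟩ := exists_longest_path
    (fun v (p : G.Walk t v) => (Walk.cons h p).IsPath ∧ ∀ x ∈ p.support, x ≠ v → deg G x = 2)
    (fun v p hp => hp.1.of_cons) ⟨t, Walk.nil, by simp [h.ne], by simp⟩
  refine ⟨v, p, hp, by simp, hu, fun hv => ?_, ?_⟩
  · obtain ⟨w, hw, hpw⟩ := exists_concat_isPath hG hp hv.ge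
    have := hmax w (p.concat hw) ⟨hpw, fun x hx hxw => ?_⟩
    · simp at this
    · rw [Walk.support_concat] at hx
      by_cases hxv : x = v
      · rwa [hxv]
      · exact hp2 x (by simpa [hxw] using hx) hxv
  · intro w hw hwu hwv
    exact hp2 w (by simpa [hwu] using hw) hwv

lemma ncard_neighborSet_segmentGraph [Fintype V] (hG : G.IsAcyclic) {u : V} (hu : deg G u ≠ 2) :
    ((segmentGraph G).neighborSet u).ncard = deg G u := by
  have key : ∀ v (hv : v ∈ (segmentGraph G).neighborSet u), ∃ t, ∃ h : G.Adj u t,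
      ∃ p : G.Walk t v, IsSegment G (Walk.cons h p) := by
    rintro v ⟨p, hp⟩
    cases p with
    | nil => exact absurd hp.2.1 (by simp)
    | cons h p => exact ⟨_, h, p, hp⟩
  have hmid : ∀ {t v : V} {h : G.Adj u t} {p : G.Walk t v}, IsSegment G (Walk.cons h p) →
      ∀ x ∈ p.support, x ≠ v → deg G x = 2 := by
    intro t v h p hp x hx hxv
    refine hp.2.2.2.2 x (by simp [hx]) (fun e => ?_) hxv
    exact ((Walk.cons_isPath_iff _ _).mp hp.1).2 (e ▸ hx)
  choose f hf p hp using key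
  refine Set.ncard_congr f (fun v hv => hf v hv) (fun v w hv hw e => ?_) (fun t ht => ?_)
  · have : ∀ {t : V} (h : G.Adj u t) (q : G.Walk t w), f v hv = t →
        IsSegment G (Walk.cons h q) → v = w := by
      rintro t h q rfl hq
      exact end_eq_of_deg_two _ _ _ (hp v hv).1 hq.1 (hp v hv).2.2.2.1 hq.2.2.2.1
        (hmid (hp v hv)) (hmid hq)
    exact this _ _ e (hp w hw)
  · obtain ⟨v, q, hq⟩ := exists_isSegment_cons hG hu (show G.Adj u t from ht)
    refine ⟨v, ⟨_, hq⟩, ?_⟩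
    have := (hG.subsingleton_path u v).elim ⟨_, hq.1⟩ ⟨_, (hp v ⟨_, hq⟩).1⟩
    have := congrArg Walk.snd (Subtype.mk.inj this)
    simpa only [Walk.snd_cons] using this.symm

/-- In a forest, the number of segments is determined by the degrees. -/
lemma two_mul_numSegments [Fintype V] (hG : G.IsAcyclic) :
    2 * numSegments G = ∑ v, if deg G v = 2 then 0 else deg G v := by
  classical
  rw [numSegments_eq_ncard_edgeSet, Set.ncard_eq_toFinset_card']
  have := (segmentGraph G).sum_degrees_eq_twice_card_edges
  rw [SimpleGraph.edgeFinset] at this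
  rw [← this]
  refine Finset.sum_congr rfl fun v _ => ?_
  rw [← ncard_neighborSet_eq_degree]
  split_ifs with h
  · rw [Set.ncard_eq_zero]
    ext w
    simp only [SimpleGraph.mem_neighborSet, Set.mem_empty_iff_false, iff_false]
    rintro ⟨p, hp⟩
    exact hp.2.2.1 h
  · exact ncard_neighborSet_segmentGraph hG h

lemma numSegments_eq_of_deg_eq [Fintype V] {G' : SimpleGraph V} (hG : G.IsAcyclic)
    (hG' : G'.IsAcyclic) (h : ∀ v, deg G' v = deg G v) : numSegments G' = numSegments G := by
  have h₁ := two_mul_numSegments hG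
  have h₂ := two_mul_numSegments hG'
  simp only [h] at h₂
  omega

lemma sum_deg [Fintype V] (G : SimpleGraph V) : ∑ v, deg G v = 2 * G.edgeSet.ncard := by
  classical
  rw [Set.ncard_eq_toFinset_card']
  have := G.sum_degrees_eq_twice_card_edges
  rw [SimpleGraph.edgeFinset] at this
  rw [← this]
  exact Finset.sum_congr rfl fun v _ => ncard_neighborSet_eq_degree G v

lemma isTree_of_connected_of_deg_eq [Fintype V] {G' : SimpleGraph V} (hG : G.IsTree)
    (hG' : G'.Connected) (h : ∀ v, deg G' v = deg G v) : G'.IsTree := by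
  rw [isTree_iff_connected_and_card] at hG ⊢
  refine ⟨hG', ?_⟩
  have h₁ := sum_deg G
  have h₂ := sum_deg G'
  simp only [h] at h₂
  have h₃ := hG.2
  rw [Nat.card_coe_set_eq] at h₃ ⊢
  omega

/-- The graph obtained by replacing the edges `ab` and `cd` with `ac` and `bd`. -/
def twoSwitch (G : SimpleGraph V) (a b c d : V) : SimpleGraph V :=
  fromEdgeSet ((G.edgeSet \ {s(a, b), s(c, d)}) ∪ {s(a, c), s(b, d)})

/-- The edges `ab` and `cd` are disjoint, while `ac` and `bd` are not edges. -/
structure IsSwitchable (G : SimpleGraph V) (a b c d : V) : Prop where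
  ab : G.Adj a b
  cd : G.Adj c d
  hac : a ≠ c
  had : a ≠ d
  hbc : b ≠ c
  hbd : b ≠ d
  nac : ¬ G.Adj a c
  nbd : ¬ G.Adj b d

variable {a b c d : V}

lemma IsSwitchable.edgeSet_twoSwitch (h : IsSwitchable G a b c d) :
    (twoSwitch G a b c d).edgeSet = (G.edgeSet \ {s(a, b), s(c, d)}) ∪ {s(a, c), s(b, d)} := by
  rw [twoSwitch, edgeSet_fromEdgeSet, sdiff_eq_left, Set.disjoint_left]
  rintro e (he | rfl | rfl) hd
  · exact G.not_isDiag_of_mem_edgeSet he.1 hd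
  · exact h.hac hd
  · exact h.hbd hd

lemma IsSwitchable.deg_twoSwitch (h : IsSwitchable G a b c d) (v : V) :
    deg (twoSwitch G a b c d) v = deg G v := by
  obtain ⟨ab, cd, hac, had, hbc, hbd, nac, nbd⟩ := h
  have hab := ab.ne
  have hcd := cd.ne
  have key : ∀ x y, x ∉ G.neighborSet v → y ∈ G.neighborSet v →
      (twoSwitch G a b c d).neighborSet v = insert x (G.neighborSet v \ {y}) →
      deg (twoSwitch G a b c d) v = deg G v := by
    intro x y hx hy e
    rw [deg, e, Set.ncard_exchange hx hy, deg]
  have hadj : ∀ x y, (twoSwitch G a b c d).Adj x y ↔ _ := fun x y => fromEdgeSet_adj _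
  have hne : ∀ x y, G.Adj x y → x ≠ y := fun x y e => e.ne
  have hsymm : ∀ x y, G.Adj x y → G.Adj y x := fun x y e => e.symm
  by_cases ha : v = a
  · subst ha
    apply key c b nac ab
    ext w
    simp [hadj]
    grind
  by_cases hb : v = b
  · subst hb
    apply key d a nbd ab.symm
    ext w
    simp [hadj]
    grind
  by_cases hc : v = c
  · subst hc
    apply key a d (fun e => nac e.symm) cd
    ext w
    simp [hadj]
    grind
  by_cases hd : v = d
  · subst hd
    apply key b c (fun e => nbd e.symm) cd.symm
    ext w
    simp [hadj]
    grind
  · unfold deg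
    congr 1
    ext w
    simp [hadj]
    grind

lemma IsSwitchable.M2_twoSwitch [Fintype V] (h : IsSwitchable G a b c d) :
    M2 (twoSwitch G a b c d) + (deg G a * deg G b + deg G c * deg G d) =
      M2 G + (deg G a * deg G c + deg G b * deg G d) := by
  classical
  have hab := h.ab.ne
  have hac := h.hac
  have had := h.had
  have hbc := h.hbc
  unfold M2
  simp only [h.deg_twoSwitch]
  set f : Sym2 V → ℕ :=
    Sym2.lift ⟨fun u w => deg G u * deg G w, fun u w => Nat.mul_comm _ _⟩ with hf
  have h₁ : (Set.toFinite (twoSwitch G a b c d).edgeSet).toFinset =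
      ((Set.toFinite G.edgeSet).toFinset \ {s(a, b), s(c, d)}) ∪ {s(a, c), s(b, d)} := by
    ext e
    simp [h.edgeSet_twoSwitch]
  have h₂ : Disjoint ((Set.toFinite G.edgeSet).toFinset \ {s(a, b), s(c, d)})
      {s(a, c), s(b, d)} := by
    simp [Finset.disjoint_insert_right, h.nac, h.nbd]
  have h₃ : ({s(a, b), s(c, d)} : Finset (Sym2 V)) ⊆ (Set.toFinite G.edgeSet).toFinset := by
    simp [Set.insert_subset_iff, h.ab, h.cd]
  rw [h₁, Finset.sum_union h₂, ← Finset.sum_sdiff h₃,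
    Finset.sum_pair (a := s(a, c)) (b := s(b, d)) (by simp; grind),
    Finset.sum_pair (a := s(a, b)) (b := s(c, d)) (by simp; grind)]
  simp only [hf, Sym2.lift_mk]
  ring

lemma connected_twoSwitch (hG : G.Connected) {hab : G.Adj a b} {p : G.Walk b c}
    {hcd : G.Adj c d} (hp : ((Walk.cons hab p).concat hcd).IsPath) (hbc : b ≠ c) :
    (twoSwitch G a b c d).Connected := by
  obtain ⟨hp₁, hd⟩ := (Walk.concat_isPath_iff _).mp hp
  obtain ⟨hp₂, ha⟩ := (Walk.cons_isPath_iff _ _).mp hp₁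
  rw [Walk.support_cons, List.mem_cons, not_or] at hd
  have hac : (twoSwitch G a b c d).Adj a c := by
    simp only [twoSwitch, fromEdgeSet_adj]
    exact ⟨by simp, fun e => ha (e ▸ p.end_mem_support)⟩
  have hbd : (twoSwitch G a b c d).Adj b d := by
    simp only [twoSwitch, fromEdgeSet_adj]
    exact ⟨by simp, fun e => hd.2 (e ▸ p.start_mem_support)⟩
  have hbc' : (twoSwitch G a b c d).Reachable b c := by
    refine ⟨p.transfer _ fun e he => ?_⟩
    rw [twoSwitch, edgeSet_fromEdgeSet]
    refine ⟨Or.inl ⟨p.edges_subset_edgeSet he, ?_⟩,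
      G.not_isDiag_of_mem_edgeSet (p.edges_subset_edgeSet he)⟩
    rintro (rfl | rfl)
    · exact ha (p.fst_mem_support_of_mem_edges he)
    · exact hd.2 (p.snd_mem_support_of_mem_edges he)
  have key : ∀ x y, G.Adj x y → (twoSwitch G a b c d).Reachable x y := by
    intro x y hxy
    by_cases hx : s(x, y) ∈ ({s(a, b), s(c, d)} : Set (Sym2 V))
    · have h₁ : (twoSwitch G a b c d).Reachable a b := hac.reachable.trans hbc'.symm
      have h₂ : (twoSwitch G a b c d).Reachable c d := hbc'.symm.trans hbd.reachable
      simp only [Set.mem_insert_iff, Set.mem_singleton_iff, Sym2.eq_iff] at hx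
      rcases hx with (⟨rfl, rfl⟩ | ⟨rfl, rfl⟩) | (⟨rfl, rfl⟩ | ⟨rfl, rfl⟩)
      exacts [h₁, h₁.symm, h₂, h₂.symm]
    · refine Adj.reachable ?_
      simp only [twoSwitch, fromEdgeSet_adj]
      exact ⟨Or.inl ⟨hxy, hx⟩, hxy.ne⟩
  have := hG.nonempty
  refine ⟨fun x y => ?_⟩
  obtain ⟨w⟩ := hG.preconnected x y
  induction w with
  | nil => rfl
  | cons h _ ih => exact (key _ _ h).trans ih

lemma isSwitchable_of_isPath (hG : G.IsAcyclic) {hab : G.Adj a b} {p : G.Walk b c}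
    {hcd : G.Adj c d} (hp : ((Walk.cons hab p).concat hcd).IsPath) (hbc : b ≠ c) :
    IsSwitchable G a b c d := by
  obtain ⟨hp₁, hd⟩ := (Walk.concat_isPath_iff _).mp hp
  obtain ⟨hp₂, ha⟩ := (Walk.cons_isPath_iff _ _).mp hp₁
  rw [Walk.support_cons, List.mem_cons, not_or] at hd
  refine ⟨hab, hcd, fun e => ha (e ▸ p.end_mem_support), fun e => hd.1 e.symm, hbc,
    fun e => hd.2 (e ▸ p.start_mem_support), fun h => ?_, fun h => ?_⟩
  · have := hG.eq_snd_of_adj_start hp₁ h (by simp)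
    simp only [Walk.snd_cons] at this
    exact hbc this.symm
  · have hpc : (p.concat hcd).IsPath := hp₂.concat hd.2 hcd
    have := hG.eq_penultimate_of_adj_end hpc h.symm (by simp [Walk.support_concat])
    rw [Walk.penultimate_concat] at this
    exact hbc this

end ChemTree

theorem stmt_6 {V : Type*} [Fintype V] (n k : ℕ)
    (hcard : Fintype.card V = n) (hk3 : 3 ≤ k) (hkn : k + 1 ≤ n)
    (T : SimpleGraph V) (hT : IsChemicalTree T) (hseg : numSegments T = k)
    (hmax : ∀ T' : SimpleGraph V, IsChemicalTree T' → numSegments T' = k →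
      M2 T' ≤ M2 T) :
    ∀ (u v : V) (p : T.Walk u v), IsInternalPath T p → p.length ≤ 1 := by
  intro u v p hp
  by_contra! hlen
  cases p with
  | nil => simp at hlen
  | @cons _ x _ hux p =>
  obtain ⟨hpath, -, hu, hv, hmid⟩ := hp
  have hxv : x ≠ v := by
    rintro rfl
    have := Walk.length_eq_zero_iff.mpr (Walk.isPath_iff_nil.mp hpath.of_cons)
    simp [this] at hlen
  have hx : deg T x = 2 := hmid x (by simp) hux.ne' hxv
  obtain ⟨w, q, ⟨hq, hw⟩, hqmax⟩ := exists_longest_path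
    (fun w (q : T.Walk x w) => (Walk.cons hux q).IsPath ∧ 3 ≤ deg T w)
    (fun w q hq => hq.1.of_cons) ⟨v, p, hpath, hv⟩
  obtain ⟨y, hwy, hqy⟩ := exists_concat_isPath hT.1.isAcyclic hq (by omega)
  have hy : deg T y ≤ 2 := by
    by_contra! hy
    have := hqmax y (q.concat hwy) ⟨hqy, hy⟩
    simp at this
  have hxw : x ≠ w := by
    rintro rfl
    omega
  have hsw := isSwitchable_of_isPath hT.1.isAcyclic hqy hxw
  have htree := isTree_of_connected_of_deg_eq hT.1
    (connected_twoSwitch hT.1.connected hqy hxw) hsw.deg_twoSwitch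
  have hle := hmax (twoSwitch T u x w y) ⟨htree, fun z => hsw.deg_twoSwitch z ▸ hT.2 z⟩
    ((numSegments_eq_of_deg_eq hT.1.isAcyclic htree.isAcyclic hsw.deg_twoSwitch).trans hseg)
  have hM2 := hsw.M2_twoSwitch
  rw [hx] at hM2
  nlinarith
end

section
/- Let 3 ≤ k ≤ n−1 and let T be an n-vertex chemical tree with exactly k segments such that M2(T') ≤ M2(T) for every n-vertex chemical tree T' with exactly k segments. If T contains a pendent vertex adjacent to a vertex of degree 4, then T does not contain any vertex of degree 3 adjacent to a vertex of degree 2. -/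
open SimpleGraph

namespace ChemTree

variable {V : Type*}

/-- The graph obtained from `G` by replacing the edge `ab` by the path `a - y - b`. -/
def subdivide (G : SimpleGraph V) (a b y : V) : SimpleGraph V :=
  SimpleGraph.fromEdgeSet (insert s(a, y) (insert s(b, y) (G.edgeSet \ {s(a, b)})))

section Subdivide

variable {G : SimpleGraph V} {a b y : V}

lemma subdivide_adj (hay : a ≠ y) (hby : b ≠ y) {p q : V} :
    (subdivide G a b y).Adj p q ↔
      s(p, q) = s(a, y) ∨ s(p, q) = s(b, y) ∨ (G.Adj p q ∧ s(p, q) ≠ s(a, b)) := by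
  simp only [subdivide, fromEdgeSet_adj, Set.mem_insert_iff, Set.mem_sdiff, mem_edgeSet,
    Set.mem_singleton_iff, and_iff_left_iff_imp]
  rintro (h | h | h)
  · rintro rfl
    rw [Sym2.eq_iff] at h
    grind
  · rintro rfl
    rw [Sym2.eq_iff] at h
    grind
  · exact h.1.ne

lemma edgeSet_subdivide (hay : a ≠ y) (hby : b ≠ y) :
    (subdivide G a b y).edgeSet =
      insert s(a, y) (insert s(b, y) (G.edgeSet \ {s(a, b)})) := by
  ext e
  induction e with
  | h p q => simp [subdivide_adj hay hby]

lemma subdivide_comm : subdivide G a b y = subdivide G b a y := by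
  rw [subdivide, subdivide, Set.insert_comm, Sym2.eq_swap (a := a) (b := b)]

lemma ne_left_of_isolated (hy : ∀ p, ¬ G.Adj y p) (hab : G.Adj a b) : a ≠ y := by
  rintro rfl
  exact hy _ hab

lemma ne_right_of_isolated (hy : ∀ p, ¬ G.Adj y p) (hab : G.Adj a b) : b ≠ y :=
  ne_left_of_isolated hy hab.symm

lemma deg_subdivide_self (hy : ∀ p, ¬ G.Adj y p) (hab : G.Adj a b) :
    deg (subdivide G a b y) y = 2 := by
  have hay := ne_left_of_isolated hy hab
  have hby := ne_right_of_isolated hy hab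
  have : (subdivide G a b y).neighborSet y = {a, b} := by
    ext q
    have := hy q
    simp only [mem_neighborSet, subdivide_adj hay hby, Sym2.eq_iff, Set.mem_insert_iff,
      Set.mem_singleton_iff]
    grind
  rw [deg, this, Set.ncard_pair hab.ne]

lemma deg_subdivide_left [Finite V] (hy : ∀ p, ¬ G.Adj y p) (hab : G.Adj a b) :
    deg (subdivide G a b y) a = deg G a := by
  have hay := ne_left_of_isolated hy hab
  have hby := ne_right_of_isolated hy hab
  have : (subdivide G a b y).neighborSet a = insert y (G.neighborSet a \ {b}) := by
    ext q
    have := hab.ne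
    simp only [mem_neighborSet, subdivide_adj hay hby, Sym2.eq_iff, Set.mem_insert_iff,
      Set.mem_sdiff, Set.mem_singleton_iff, ne_eq]
    grind
  have hya : y ∉ G.neighborSet a := fun h => hy a (G.adj_symm h)
  have hba : b ∈ G.neighborSet a := hab
  rw [deg, deg, this, Set.ncard_exchange hya hba]

lemma deg_subdivide_of_ne [Finite V] (hy : ∀ p, ¬ G.Adj y p) (hab : G.Adj a b) {p : V}
    (hp : p ≠ y) : deg (subdivide G a b y) p = deg G p := by
  by_cases hpa : p = a
  · subst hpa
    exact deg_subdivide_left hy hab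
  by_cases hpb : p = b
  · subst hpb
    rw [subdivide_comm]
    exact deg_subdivide_left hy hab.symm
  have hay := ne_left_of_isolated hy hab
  have hby := ne_right_of_isolated hy hab
  refine congrArg Set.ncard (Set.ext fun q => ?_)
  simp only [mem_neighborSet, subdivide_adj hay hby, Sym2.eq_iff, ne_eq]
  grind

lemma exists_walk_subdivide (hy : ∀ p, ¬ G.Adj y p) (hab : G.Adj a b) {S : Set V}
    (hyS : y ∈ S) {c e : V} (w : G.Walk c e) (hw : ∀ p ∈ w.support, p ∈ S) :
    ∃ w' : (subdivide G a b y).Walk c e, ∀ p ∈ w'.support, p ∈ S := by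
  have hay := ne_left_of_isolated hy hab
  have hby := ne_right_of_isolated hy hab
  induction w with
  | nil => exact ⟨.nil, by simpa using hw⟩
  | @cons c d e h w ih =>
    simp only [Walk.support_cons, List.mem_cons, forall_eq_or_imp] at hw
    obtain ⟨w', hw'⟩ := ih hw.2
    by_cases hcd : s(c, d) = s(a, b)
    · have h₁ : (subdivide G a b y).Adj c y := by
        rw [subdivide_adj hay hby]
        rw [Sym2.eq_iff] at hcd
        grind
      have h₂ : (subdivide G a b y).Adj y d := by
        rw [subdivide_adj hay hby]
        simp only [Sym2.eq_iff] at hcd ⊢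
        grind
      exact ⟨.cons h₁ (.cons h₂ w'), by simpa using ⟨hw.1, hyS, hw'⟩⟩
    · have h₁ : (subdivide G a b y).Adj c d :=
        (subdivide_adj hay hby).2 (Or.inr (Or.inr ⟨h, hcd⟩))
      exact ⟨.cons h₁ w', by simpa using ⟨hw.1, hw'⟩⟩

lemma exists_walk_of_subdivide_aux (hy : ∀ p, ¬ G.Adj y p) (hab : G.Adj a b) {S : Set V}
    {c e : V} (he : e ≠ y) (w : (subdivide G a b y).Walk c e) (hw : ∀ p ∈ w.support, p ∈ S) :
    (c ≠ y → ∃ w' : G.Walk c e, ∀ p ∈ w'.support, p ∈ S) ∧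
      (c = y → (∃ w' : G.Walk a e, ∀ p ∈ w'.support, p ∈ S) ∨
        ∃ w' : G.Walk b e, ∀ p ∈ w'.support, p ∈ S) := by
  have hay := ne_left_of_isolated hy hab
  have hby := ne_right_of_isolated hy hab
  induction w with
  | nil => exact ⟨fun _ => ⟨.nil, by simpa using hw⟩, fun h => absurd h he⟩
  | @cons c d e h w ih =>
    simp only [Walk.support_cons, List.mem_cons, forall_eq_or_imp] at hw
    obtain ⟨ih₁, ih₂⟩ := ih he hw.2
    have extend : ∀ {c d : V}, G.Adj c d → c ∈ S →
        (∃ w' : G.Walk d e, ∀ p ∈ w'.support, p ∈ S) →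
        ∃ w' : G.Walk c e, ∀ p ∈ w'.support, p ∈ S := by
      rintro c d hcd hc ⟨w', hw'⟩
      exact ⟨.cons hcd w', by simpa using ⟨hc, hw'⟩⟩
    rw [subdivide_adj hay hby, Sym2.eq_iff, Sym2.eq_iff] at h
    constructor
    · intro hc
      rcases h with (⟨rfl, rfl⟩ | ⟨rfl, rfl⟩) | (⟨rfl, rfl⟩ | ⟨rfl, rfl⟩) | ⟨h, -⟩
      · exact (ih₂ rfl).elim id (extend hab hw.1)
      · exact absurd rfl hc
      · exact (ih₂ rfl).elim (extend hab.symm hw.1) id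
      · exact absurd rfl hc
      · exact extend h hw.1 (ih₁ fun hd => hy c (hd ▸ h.symm))
    · rintro rfl
      rcases h with (⟨rfl, rfl⟩ | ⟨-, rfl⟩) | (⟨rfl, rfl⟩ | ⟨-, rfl⟩) | ⟨h, -⟩
      · exact absurd rfl hay
      · exact Or.inl (ih₁ hay)
      · exact absurd rfl hby
      · exact Or.inr (ih₁ hby)
      · exact absurd h (hy d)

/-- Walks inside a set containing the subdivision vertex exist before the subdivision if and
only if they exist after it. -/
lemma exists_walk_subdivide_iff (hy : ∀ p, ¬ G.Adj y p) (hab : G.Adj a b) {S : Set V}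
    (hyS : y ∈ S) {c e : V} (hc : c ≠ y) (he : e ≠ y) :
    (∃ w : (subdivide G a b y).Walk c e, ∀ p ∈ w.support, p ∈ S) ↔
      ∃ w : G.Walk c e, ∀ p ∈ w.support, p ∈ S :=
  ⟨fun ⟨w, hw⟩ => (exists_walk_of_subdivide_aux hy hab he w hw).1 hc,
    fun ⟨w, hw⟩ => exists_walk_subdivide hy hab hyS w hw⟩

lemma ncard_edgeSet_subdivide [Finite V] (hy : ∀ p, ¬ G.Adj y p) (hab : G.Adj a b) :
    (subdivide G a b y).edgeSet.ncard = G.edgeSet.ncard + 1 := by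
  have hay := ne_left_of_isolated hy hab
  have hby := ne_right_of_isolated hy hab
  rw [edgeSet_subdivide hay hby, Set.ncard_insert_of_notMem, Set.ncard_exchange]
  · simpa using fun h => absurd h.symm (hy b)
  · simpa using hab
  · have := hab.ne
    have := hy a
    simp only [Set.mem_insert_iff, Sym2.eq_iff, Set.mem_sdiff, mem_edgeSet, G.adj_comm a y]
    grind

lemma M2_subdivide [Fintype V] (hy : ∀ p, ¬ G.Adj y p) (hab : G.Adj a b) :
    M2 (subdivide G a b y) + deg G a * deg G b = M2 G + 2 * (deg G a + deg G b) := by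
  classical
  have hay := ne_left_of_isolated hy hab
  have hby := ne_right_of_isolated hy hab
  let E := (Set.toFinite G.edgeSet).toFinset
  have hE : (Set.toFinite (subdivide G a b y).edgeSet).toFinset =
      insert s(a, y) (insert s(b, y) (E.erase s(a, b))) := by
    ext e
    simp only [edgeSet_subdivide hay hby, Set.Finite.mem_toFinset, Set.mem_insert_iff,
      Set.mem_sdiff, Set.mem_singleton_iff, Finset.mem_insert, Finset.mem_erase, E]
    tauto
  have hb : s(b, y) ∉ E.erase s(a, b) := by
    simp [E, G.adj_comm b y, hy b]
  have ha : s(a, y) ∉ insert s(b, y) (E.erase s(a, b)) := by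
    have := hab.ne
    have := hy a
    simp only [Finset.mem_insert, Sym2.eq_iff, Finset.mem_erase, E, Set.Finite.mem_toFinset,
      mem_edgeSet, G.adj_comm a y]
    grind
  have habE : s(a, b) ∈ E := by simpa [E] using hab
  have hsum : ∑ e ∈ E.erase s(a, b), Sym2.lift ⟨fun u w => deg (subdivide G a b y) u *
        deg (subdivide G a b y) w, fun u w => Nat.mul_comm _ _⟩ e =
      ∑ e ∈ E.erase s(a, b), Sym2.lift ⟨fun u w => deg G u * deg G w,
        fun u w => Nat.mul_comm _ _⟩ e := by
    refine Finset.sum_congr rfl fun e he => ?_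
    induction e with
    | h p q =>
      have hpq : G.Adj p q := by simpa [E] using Finset.mem_of_mem_erase he
      simp only [Sym2.lift_mk]
      rw [deg_subdivide_of_ne hy hab (ne_left_of_isolated hy hpq),
        deg_subdivide_of_ne hy hab (ne_right_of_isolated hy hpq)]
  rw [M2, M2, hE, Finset.sum_insert ha, Finset.sum_insert hb, hsum,
    ← Finset.add_sum_erase E _ habE]
  simp only [Sym2.lift_mk, deg_subdivide_self hy hab, deg_subdivide_of_ne hy hab hay,
    deg_subdivide_of_ne hy hab hby]
  ring

end Subdivide

lemma exists_isSegment_iff {G : SimpleGraph V} {a b : V} :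
    (∃ p : G.Walk a b, IsSegment G p) ↔ a ≠ b ∧ deg G a ≠ 2 ∧ deg G b ≠ 2 ∧
      ∃ p : G.Walk a b, ∀ w ∈ p.support, w ∈ {w | w ≠ a → w ≠ b → deg G w = 2} := by
  classical
  constructor
  · rintro ⟨p, hp, hl, ha, hb, h⟩
    refine ⟨?_, ha, hb, p, h⟩
    rintro rfl
    have := Walk.length_eq_zero_iff.2 (Walk.isPath_iff_nil.1 hp)
    omega
  · rintro ⟨hne, ha, hb, p, h⟩
    refine ⟨p.bypass, p.bypass_isPath, ?_, ha, hb, fun w hw => h w (p.support_bypass_subset_support hw)⟩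
    rw [Nat.pos_iff_ne_zero]
    exact fun h => hne (Walk.eq_of_length_eq_zero h)

section Move

variable {G : SimpleGraph V} {a b c d y : V}

/-- The degrees do not depend on the edge that is subdivided. -/
lemma deg_subdivide_eq [Finite V] (hy : ∀ p, ¬ G.Adj y p) (hab : G.Adj a b) (hcd : G.Adj c d) :
    deg (subdivide G a b y) = deg (subdivide G c d y) := by
  funext p
  by_cases hp : p = y
  · rw [hp, deg_subdivide_self hy hab, deg_subdivide_self hy hcd]
  · rw [deg_subdivide_of_ne hy hab hp, deg_subdivide_of_ne hy hcd hp]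

/-- The number of segments does not depend on the edge that is subdivided. -/
lemma numSegments_subdivide_eq [Finite V] (hy : ∀ p, ¬ G.Adj y p) (hab : G.Adj a b)
    (hcd : G.Adj c d) :
    numSegments (subdivide G a b y) = numSegments (subdivide G c d y) := by
  unfold numSegments
  congr 1
  ext s
  refine exists_congr fun p => exists_congr fun q => ?_
  rw [exists_and_left, exists_and_left, exists_isSegment_iff, exists_isSegment_iff,
    deg_subdivide_eq hy hab hcd]
  have h2 := deg_subdivide_self hy hcd
  refine and_congr_right fun _ => and_congr_right fun _ => and_congr_right fun hp =>
    and_congr_right fun hq => ?_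
  have hp' : p ≠ y := fun h => hp (h ▸ h2)
  have hq' : q ≠ y := fun h => hq (h ▸ h2)
  have hyS : y ∈ {w | w ≠ p → w ≠ q → deg (subdivide G c d y) w = 2} := fun _ _ => h2
  rw [exists_walk_subdivide_iff hy hab hyS hp' hq', exists_walk_subdivide_iff hy hcd hyS hp' hq']

lemma connected_subdivide (hy : ∀ p, ¬ G.Adj y p) (hab : G.Adj a b) (hcd : G.Adj c d)
    (h : (subdivide G a b y).Connected) : (subdivide G c d y).Connected := by
  have hcy := ne_left_of_isolated hy hcd
  have hdy := ne_right_of_isolated hy hcd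
  have hreach : ∀ p, (subdivide G c d y).Reachable p c := by
    intro p
    by_cases hp : p = y
    · subst hp
      exact (((subdivide_adj hcy hdy).2 (Or.inl rfl)).symm).reachable
    · obtain ⟨w⟩ := h.preconnected p c
      obtain ⟨w', -⟩ := (exists_walk_subdivide_iff hy hcd (Set.mem_univ y) hp hcy).2
        ((exists_walk_subdivide_iff hy hab (Set.mem_univ y) hp hcy).1 ⟨w, by simp⟩)
      exact ⟨w'⟩
  exact (connected_iff _).2 ⟨fun p q => (hreach p).trans (hreach q).symm, ⟨c⟩⟩

lemma isTree_subdivide [Finite V] (hy : ∀ p, ¬ G.Adj y p) (hab : G.Adj a b) (hcd : G.Adj c d)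
    (h : (subdivide G a b y).IsTree) : (subdivide G c d y).IsTree := by
  rw [isTree_iff_connected_and_card] at h ⊢
  refine ⟨connected_subdivide hy hab hcd h.1, ?_⟩
  rw [Nat.card_coe_set_eq] at h ⊢
  rw [ncard_edgeSet_subdivide hy hcd, ← ncard_edgeSet_subdivide hy hab, h.2]

end Move

/-- The graph obtained from `G` by deleting all edges at `y` and adding the edge `xz`. -/
def smooth (G : SimpleGraph V) (x z y : V) : SimpleGraph V :=
  SimpleGraph.fromEdgeSet (insert s(x, z) {e ∈ G.edgeSet | y ∉ e})

lemma smooth_adj {G : SimpleGraph V} {x z y : V} (hxz : x ≠ z) {p q : V} :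
    (smooth G x z y).Adj p q ↔ s(p, q) = s(x, z) ∨ (G.Adj p q ∧ p ≠ y ∧ q ≠ y) := by
  simp only [smooth, fromEdgeSet_adj, Set.mem_insert_iff, Set.mem_ofPred_eq, mem_edgeSet,
    Sym2.mem_iff, Sym2.eq_iff]
  have := G.ne_of_adj (a := p) (b := q)
  grind

lemma subdivide_smooth {G : SimpleGraph V} {x z y : V} (hxz : x ≠ z)
    (hN : ∀ q, G.Adj y q ↔ q = x ∨ q = z) (hnadj : ¬ G.Adj x z) :
    subdivide (smooth G x z y) x z y = G := by
  have hx := ((hN x).2 (Or.inl rfl)).ne'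
  have hz := ((hN z).2 (Or.inr rfl)).ne'
  ext p q
  rw [subdivide_adj hx hz, smooth_adj hxz]
  simp only [Sym2.eq_iff]
  have hp := hN p
  have hq := hN q
  have := G.adj_comm p q
  have := G.adj_comm x z
  grind

end ChemTree

open ChemTree

theorem stmt_8 {V : Type*} [Fintype V] (n k : ℕ)
    (hcard : Fintype.card V = n) (hk3 : 3 ≤ k) (hkn : k + 1 ≤ n)
    (T : SimpleGraph V) (hT : IsChemicalTree T) (hseg : numSegments T = k)
    (hmax : ∀ T' : SimpleGraph V, IsChemicalTree T' → numSegments T' = k →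
      M2 T' ≤ M2 T)
    (hpend : ∃ u v : V, deg T u = 1 ∧ deg T v = 4 ∧ T.Adj u v) :
    ∀ x y : V, deg T x = 3 → deg T y = 2 → ¬ T.Adj x y := by
  intro x y hx hy hxy
  obtain ⟨u, v, hu, hv, huv⟩ := hpend
  obtain ⟨z, hxz, hN⟩ : ∃ z, x ≠ z ∧ ∀ q, T.Adj y q ↔ q = x ∨ q = z := by
    obtain ⟨s, t, hst, h⟩ := Set.ncard_eq_two.1 hy
    have hN : ∀ q, T.Adj y q ↔ q = s ∨ q = t := fun q => by
      rw [← mem_neighborSet, h]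
      simp
    rcases (hN x).1 hxy.symm with rfl | rfl
    · exact ⟨t, hst, hN⟩
    · exact ⟨s, hst.symm, fun q => (hN q).trans or_comm⟩
  have hyz : T.Adj y z := (hN z).2 (Or.inr rfl)
  have hnadj : ¬ T.Adj x z := by
    intro h
    exact hT.1.isAcyclic (.cons h (.cons hyz.symm (.cons hxy.symm .nil)))
      (by simp [Walk.isCycle_def, Walk.isTrail_def, hxz, hxz.symm, hxy.ne, hyz.ne',
        hxy.ne'])
  have hsub := subdivide_smooth hxz hN hnadj
  set G := smooth T x z y with hG
  have hiso : ∀ p, ¬ G.Adj y p := by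
    intro p
    have := hxy.ne
    have := hyz.ne
    rw [hG, smooth_adj hxz, Sym2.eq_iff]
    grind
  have hGxz : G.Adj x z := (smooth_adj hxz).2 (Or.inl rfl)
  have hGuv : G.Adj u v := by
    refine (smooth_adj hxz).2 (Or.inr ⟨huv, ?_, ?_⟩) <;> rintro rfl <;> omega
  have hdeg := deg_subdivide_eq hiso hGuv hGxz
  have hseg' := numSegments_subdivide_eq hiso hGuv hGxz
  rw [hsub] at hdeg hseg'
  have hle := hmax (subdivide G u v y)
    ⟨isTree_subdivide hiso hGxz hGuv (hsub.symm ▸ hT.1), fun p => hdeg ▸ hT.2 p⟩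
    (hseg'.trans hseg)
  have hdegG : ∀ {p}, p ≠ y → deg G p = deg T p := fun hp => by
    rw [← deg_subdivide_of_ne hiso hGxz hp, hsub]
  have hM := M2_subdivide hiso hGxz
  have hM' := M2_subdivide hiso hGuv
  rw [hsub, hdegG hxy.ne, hdegG hyz.ne', hx] at hM
  rw [hdegG (ne_left_of_isolated hiso hGuv), hdegG (ne_right_of_isolated hiso hGuv), hu, hv]
    at hM'
  have hz : 0 < deg T z := (Set.ncard_pos).2 ⟨y, hyz.symm⟩
  omega
end
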